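/- arXiv:1508.02043 — 3 statements merged into one kernel-verified Lean document; each statement's English description precedes it below -/
import Mathlib

section
/- There exists a constant c > 0 such that k^{α+2} · Σ_{j ≥ k} p_α(j) → c as k → ∞; that is, if D_α has probability mass function p_α then P(D_α ≥ k) ∼ c/k^{α+2}. -/
open Filter

/-- The limiting degree distribution of the preferential attachment tree with parameter `α`:
`p_α(k) = (2+α) · (∏_{j=1}^{k−1}(j+α)) / (∏_{j=3}^{k+2}(j+2α))`. -/
noncomputable def pAlpha (α : ℝ) (k : ℕ) : ℝ :=
  (2 + α) * (∏ j ∈ Finset.Icc 1 (k - 1), ((j : ℝ) + α)) /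
    (∏ j ∈ Finset.Icc 3 (k + 2), ((j : ℝ) + 2 * α))

lemma num_eq (α : ℝ) (n : ℕ) :
    ∏ j ∈ Finset.Icc 1 n, ((j : ℝ) + α) = ∏ j ∈ Finset.range n, (α + 1 + (j : ℝ)) := by
  induction n with
  | zero => simp
  | succ n ih =>
    rw [Finset.prod_Icc_succ_top (by omega), Finset.prod_range_succ, ih]
    push_cast; ring

lemma den_eq (α : ℝ) (n : ℕ) :
    ∏ j ∈ Finset.Icc 3 (n + 2), ((j : ℝ) + 2 * α)
      = ∏ j ∈ Finset.range n, (2 * α + 3 + (j : ℝ)) := by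
  induction n with
  | zero => simp
  | succ n ih =>
    rw [show n + 1 + 2 = (n + 2) + 1 by ring, Finset.prod_Icc_succ_top (by omega),
      Finset.prod_range_succ, ih]
    push_cast; ring

/-- The tail `P(D ≥ n+1)`. -/
noncomputable def tailT (α : ℝ) (n : ℕ) : ℝ :=
  (∏ j ∈ Finset.range n, (α + 1 + (j : ℝ))) / ∏ j ∈ Finset.range n, (2 * α + 3 + (j : ℝ))

lemma pAlpha_succ (α : ℝ) (hα : 0 < α) (n : ℕ) :
    pAlpha α (n + 1) = tailT α n - tailT α (n + 1) := by
  unfold pAlpha tailT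
  rw [den_eq, Nat.add_sub_cancel, num_eq, Finset.prod_range_succ, Finset.prod_range_succ]
  have h1 : ∏ j ∈ Finset.range n, (2 * α + 3 + (j : ℝ)) ≠ 0 :=
    Finset.prod_ne_zero_iff.2 fun j _ => by positivity
  have h2 : 2 * α + 3 + (n : ℝ) ≠ 0 := by positivity
  field_simp
  ring

lemma pAlpha_nonneg (α : ℝ) (hα : 0 < α) (n : ℕ) : 0 ≤ pAlpha α n := by
  unfold pAlpha
  have h1 : 0 ≤ ∏ j ∈ Finset.Icc 1 (n - 1), ((j : ℝ) + α) :=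
    Finset.prod_nonneg fun j _ => by positivity
  have h2 : 0 ≤ ∏ j ∈ Finset.Icc 3 (n + 2), ((j : ℝ) + 2 * α) :=
    Finset.prod_nonneg fun j _ => by positivity
  positivity

lemma tail_gamma (α : ℝ) (hα : 0 < α) (n : ℕ) (hn : 0 < n) :
    (n : ℝ) ^ (α + 2) * tailT α n
      = (2 * α + 2) / α * (Real.GammaSeq (2 * α + 2) n / Real.GammaSeq α n) := by
  unfold tailT Real.GammaSeq
  rw [Finset.prod_range_succ', Finset.prod_range_succ']
  have e1 : ∏ k ∈ Finset.range n, (α + ((k + 1 : ℕ) : ℝ))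
      = ∏ j ∈ Finset.range n, (α + 1 + (j : ℝ)) :=
    Finset.prod_congr rfl fun j _ => by push_cast; ring
  have e2 : ∏ k ∈ Finset.range n, (2 * α + 2 + ((k + 1 : ℕ) : ℝ))
      = ∏ j ∈ Finset.range n, (2 * α + 3 + (j : ℝ)) :=
    Finset.prod_congr rfl fun j _ => by push_cast; ring
  rw [e1, e2]
  have h1 : ∏ j ∈ Finset.range n, (2 * α + 3 + (j : ℝ)) ≠ 0 :=
    Finset.prod_ne_zero_iff.2 fun j _ => by positivity
  have h2 : ∏ j ∈ Finset.range n, (α + 1 + (j : ℝ)) ≠ 0 :=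
    Finset.prod_ne_zero_iff.2 fun j _ => by positivity
  have hn' : (0 : ℝ) < n := by exact_mod_cast hn
  have h3 : (n : ℝ) ^ (2 * α + 2) = (n : ℝ) ^ (α + 2) * (n : ℝ) ^ α := by
    rw [← Real.rpow_add hn']; congr 1; ring
  have h4 : (n : ℝ) ^ α ≠ 0 := (Real.rpow_pos_of_pos hn' _).ne'
  have h5 : (n.factorial : ℝ) ≠ 0 := by positivity
  have h6 : 2 * α + 2 ≠ 0 := by positivity
  rw [h3]
  generalize (n : ℝ) ^ (α + 2) = X at *
  generalize (n : ℝ) ^ α = Y at *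
  generalize ∏ j ∈ Finset.range n, (2 * α + 3 + (j : ℝ)) = P at *
  generalize ∏ j ∈ Finset.range n, (α + 1 + (j : ℝ)) = Q at *
  simp only [Nat.cast_zero, add_zero]
  field_simp

lemma tail_tendsto (α : ℝ) (hα : 0 < α) :
    Tendsto (fun n : ℕ => (n : ℝ) ^ (α + 2) * tailT α n) atTop
      (nhds ((2 * α + 2) / α * (Real.Gamma (2 * α + 2) / Real.Gamma α))) := by
  have h := ((Real.GammaSeq_tendsto_Gamma (2 * α + 2)).div (Real.GammaSeq_tendsto_Gamma α)
    (Real.Gamma_pos_of_pos hα).ne').const_mul ((2 * α + 2) / α)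
  refine h.congr' ?_
  filter_upwards [eventually_gt_atTop 0] with n hn
  exact (tail_gamma α hα n hn).symm

lemma tail_zero (α : ℝ) (hα : 0 < α) : Tendsto (tailT α) atTop (nhds 0) := by
  have h0 : Tendsto (fun n : ℕ => ((n : ℝ) ^ (α + 2))⁻¹) atTop (nhds 0) :=
    ((tendsto_rpow_atTop (by positivity)).comp tendsto_natCast_atTop_atTop).inv_tendsto_atTop
  have h := h0.mul (tail_tendsto α hα)
  rw [zero_mul] at h
  refine h.congr' ?_
  filter_upwards [eventually_gt_atTop 0] with n hn
  have : (n : ℝ) ^ (α + 2) ≠ 0 := (Real.rpow_pos_of_pos (by exact_mod_cast hn) _).ne'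
  field_simp

lemma tail_sum (α : ℝ) (hα : 0 < α) (n : ℕ) :
    ∑' j : ℕ, (if n + 1 ≤ j then pAlpha α j else 0) = tailT α n := by
  have h : HasSum (fun i : ℕ => pAlpha α (i + (n + 1))) (tailT α n) := by
    rw [hasSum_iff_tendsto_nat_of_nonneg (fun i => pAlpha_nonneg α hα _)]
    have e : ∀ m : ℕ, ∑ i ∈ Finset.range m, pAlpha α (i + (n + 1))
        = tailT α n - tailT α (m + n) := by
      intro m
      induction m with
      | zero => simp
      | succ m ih =>
        rw [Finset.sum_range_succ, ih, ← add_assoc, pAlpha_succ α hα,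
          show m + 1 + n = m + n + 1 by ring]
        ring
    simp only [e]
    simpa using ((tail_zero α hα).comp (tendsto_add_atTop_nat n)).const_sub (tailT α n)
  have h2 : HasSum (fun j : ℕ => if n + 1 ≤ j then pAlpha α j else 0) (tailT α n) := by
    have h3 := (hasSum_nat_add_iff (f := fun j : ℕ => if n + 1 ≤ j then pAlpha α j else 0)
      (g := tailT α n) (n + 1)).1 (by simpa using h)
    rwa [Finset.sum_eq_zero, add_zero] at h3
    intro i hi
    have := Finset.mem_range.1 hi
    exact if_neg (by omega)
  exact h2.tsum_eq

/-- Fix `α > 0`. There exists a constant `c > 0` such that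
`k^{α+2} · Σ_{j ≥ k} p_α(j) → c` as `k → ∞`; that is, if `D_α` has pmf `p_α` then
`P(D_α ≥ k) ∼ c/k^{α+2}`. -/
theorem stmt_4 (α : ℝ) (hα : 0 < α) :
    ∃ c : ℝ, 0 < c ∧
      Tendsto (fun k : ℕ => (k : ℝ) ^ (α + 2) * ∑' j : ℕ, if k ≤ j then pAlpha α j else 0)
        atTop (nhds c) := by
  refine ⟨(2 * α + 2) / α * (Real.Gamma (2 * α + 2) / Real.Gamma α), ?_, ?_⟩
  · have := Real.Gamma_pos_of_pos hα
    have := Real.Gamma_pos_of_pos (show 0 < 2 * α + 2 by positivity)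
    positivity
  · rw [← tendsto_add_atTop_iff_nat 1]
    simp only [tail_sum α hα]
    have h1 : Tendsto (fun n : ℕ => (1 + 1 / (n : ℝ)) ^ (α + 2)) atTop (nhds 1) := by
      have := (tendsto_one_div_atTop_nhds_zero_nat (𝕜 := ℝ)).const_add 1
      simpa using this.rpow_const (p := α + 2) (Or.inr (by positivity))
    have h := h1.mul (tail_tendsto α hα)
    rw [one_mul] at h
    refine h.congr' ?_
    filter_upwards [eventually_gt_atTop 0] with n hn
    have hn' : (0 : ℝ) < n := by exact_mod_cast hn
    rw [← mul_assoc, ← Real.mul_rpow (by positivity) hn'.le]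
    congr 2
    push_cast
    field_simp
end

section
/- Fix α > 0 and set δ = (1+α)/(2+α). There exist s_0 ≥ 1 and a constant C < ∞ such that for all integers m ≥ s ≥ s_0, | ∏_{k=s}^{m} (1 − (1+α)/((2+α)k − 1)) − (s/m)^δ | ≤ C s^{δ−1}/m^δ. -/
lemma fac_eq (α : ℝ) (hα : 0 < α) (δ : ℝ) (hδ : δ = (1 + α) / (2 + α)) (x : ℝ) (hx : 1 < x) :
    1 - (1 + α) / ((2 + α) * x - 1) = (x - 1) / (x - 1 + δ) := by
  have h2 : (0:ℝ) < 2 + α := by linarith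
  have e : δ * (2 + α) = 1 + α := by rw [hδ]; field_simp
  have h0 : 0 < δ := by rw [hδ]; positivity
  have h1 : 0 < (2 + α) * x - 1 := by nlinarith
  have h3 : 0 < x - 1 + δ := by linarith
  rw [eq_div_iff h3.ne', sub_mul, div_mul_eq_mul_div, sub_eq_iff_eq_add, ← sub_eq_iff_eq_add',
    eq_div_iff h1.ne']
  linear_combination x * e - e

lemma fac_upper (δ x : ℝ) (h0 : 0 < δ) (h1 : δ ≤ 1) (hx : 0 < x) :
    x / (x + δ) ≤ (x / (x + 1)) ^ δ := by
  have hb := rpow_one_add_le_one_add_mul_self (s := 1 / x) (p := δ)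
    (by have : 0 < 1 / x := by positivity
        linarith) h0.le h1
  have e1 : x / (x + δ) = (1 + δ * (1 / x))⁻¹ := by field_simp
  have e2 : x / (x + 1) = (1 + 1 / x)⁻¹ := by field_simp
  rw [e1, e2, Real.inv_rpow (by positivity)]
  exact inv_anti₀ (by positivity) hb

lemma fac_lower (δ x : ℝ) (h0 : 0 < δ) (h1 : δ ≤ 1) (hx : 1 ≤ x) :
    ((x - 1) / x) ^ δ ≤ x / (x + δ) := by
  have hx0 : 0 < x := by linarith
  have hb := rpow_one_add_le_one_add_mul_self (s := -(1 / x)) (p := δ)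
    (by have : 1 / x ≤ 1 := by rw [div_le_one hx0]; exact hx
        linarith) h0.le h1
  have e2 : (x - 1) / x = 1 + -(1 / x) := by field_simp; ring
  rw [e2]
  refine hb.trans ?_
  rw [le_div_iff₀ (by positivity)]
  have : (1 + δ * -(1 / x)) * (x + δ) = x - δ ^ 2 / x := by field_simp; ring
  rw [this]
  have : 0 ≤ δ ^ 2 / x := by positivity
  linarith

lemma prod_bounds (α : ℝ) (hα : 0 < α) (δ : ℝ) (hδ : δ = (1 + α) / (2 + α)) (h0 : 0 < δ)
    (h1 : δ ≤ 1) (s m : ℕ) (hs : 3 ≤ s) (hm : s ≤ m) :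
    (((s : ℝ) - 2) / ((m : ℝ) - 1)) ^ δ ≤
      (∏ k ∈ Finset.Icc s m, (1 - (1 + α) / ((2 + α) * (k : ℝ) - 1))) ∧
    (∏ k ∈ Finset.Icc s m, (1 - (1 + α) / ((2 + α) * (k : ℝ) - 1))) ≤ ((s : ℝ) / m) ^ δ := by
  have hs' : (3:ℝ) ≤ s := by exact_mod_cast hs
  induction m, hm using Nat.le_induction with
  | base =>
    rw [Finset.Icc_self, Finset.prod_singleton, fac_eq α hα δ hδ _ (by linarith)]
    constructor
    · have := fac_lower δ ((s:ℝ) - 1) h0 h1 (by linarith)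
      rwa [show (s:ℝ) - 1 - 1 = s - 2 by ring] at this
    · rw [div_self (by linarith), Real.one_rpow, div_le_one (by linarith)]
      linarith
  | succ m hm ih =>
    have hm' : (s:ℝ) ≤ m := by exact_mod_cast hm
    rw [Finset.prod_Icc_succ_top (by omega)]
    push_cast
    rw [fac_eq α hα δ hδ ((m:ℝ) + 1) (by linarith), add_sub_cancel_right]
    have hf : 0 ≤ (m:ℝ) / (m + δ) := div_nonneg (by linarith) (by linarith)
    obtain ⟨ihl, ihu⟩ := ih
    have hq : 0 ≤ ((s:ℝ) - 2) / ((m:ℝ) - 1) := div_nonneg (by linarith) (by linarith)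
    have hm0 : (m:ℝ) ≠ 0 := by linarith
    have hm1 : (m:ℝ) - 1 ≠ 0 := by linarith
    have hm2 : (m:ℝ) + 1 ≠ 0 := by linarith
    constructor
    · have e : ((s:ℝ) - 2) / m = ((s:ℝ) - 2) / ((m:ℝ) - 1) * (((m:ℝ) - 1) / m) := by field_simp
      rw [e, Real.mul_rpow hq (div_nonneg (by linarith) (by linarith))]
      exact mul_le_mul ihl (fac_lower δ m h0 h1 (by linarith))
        (Real.rpow_nonneg (div_nonneg (by linarith) (by linarith)) _)
        ((Real.rpow_nonneg hq _).trans ihl)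
    · have e : (s:ℝ) / (m + 1) = (s:ℝ) / m * ((m:ℝ) / (m + 1)) := by field_simp
      rw [e, Real.mul_rpow (by positivity) (by positivity)]
      exact mul_le_mul ihu (fac_upper δ m h0 h1 (by linarith)) hf (by positivity)

/-- Fix `α > 0` and set `δ = (1+α)/(2+α)`. There exist `s₀ ≥ 1` and a constant
`C < ∞` such that for all integers `m ≥ s ≥ s₀`,
`| ∏_{k=s}^{m} (1 − (1+α)/((2+α)k − 1)) − (s/m)^δ | ≤ C s^{δ−1}/m^δ`. -/
theorem stmt_15 (α : ℝ) (hα : 0 < α) (δ : ℝ) (hδ : δ = (1 + α) / (2 + α)) :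
    ∃ s₀ : ℕ, 1 ≤ s₀ ∧ ∃ C : ℝ, 0 < C ∧ ∀ s m : ℕ, s₀ ≤ s → s ≤ m →
      |(∏ k ∈ Finset.Icc s m, (1 - (1 + α) / ((2 + α) * (k : ℝ) - 1))) - ((s : ℝ) / m) ^ δ|
        ≤ C * (s : ℝ) ^ (δ - 1) / (m : ℝ) ^ δ := by
  have h0 : 0 < δ := by rw [hδ]; positivity
  have h1 : δ ≤ 1 := by rw [hδ, div_le_one (by linarith)]; linarith
  refine ⟨3, by norm_num, 2, by norm_num, fun s m hs hm => ?_⟩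
  obtain ⟨hl, hu⟩ := prod_bounds α hα δ hδ h0 h1 s m hs hm
  have hs' : (3:ℝ) ≤ s := by exact_mod_cast hs
  have hm' : (s:ℝ) ≤ m := by exact_mod_cast hm
  have hs0 : (0:ℝ) < s := by linarith
  have hm0 : (0:ℝ) < m := by linarith
  rw [abs_of_nonpos (by linarith)]
  have hA : 0 ≤ 1 - 2 / (s:ℝ) := by
    rw [sub_nonneg, div_le_one hs0]; linarith
  have hA1 : 1 - 2 / (s:ℝ) ≤ 1 := by
    have : 0 < 2 / (s:ℝ) := by positivity
    linarith
  have k1 : ((s:ℝ) / m) ^ δ * (1 - 2 / (s:ℝ)) ≤ (((s : ℝ) - 2) / ((m : ℝ) - 1)) ^ δ := by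
    calc ((s:ℝ) / m) ^ δ * (1 - 2 / (s:ℝ)) ≤ ((s:ℝ) / m) ^ δ * (1 - 2 / (s:ℝ)) ^ δ := by
          gcongr
          exact Real.self_le_rpow_of_le_one hA hA1 h1
      _ = (((s : ℝ) - 2) / m) ^ δ := by
          rw [← Real.mul_rpow (by positivity) hA]
          congr 1
          field_simp
      _ ≤ _ := by
          apply Real.rpow_le_rpow (div_nonneg (by linarith) hm0.le) _ h0.le
          exact div_le_div_of_nonneg_left (by linarith) (by linarith) (by linarith)
  have k2 : 2 * (s : ℝ) ^ (δ - 1) / (m : ℝ) ^ δ = ((s:ℝ) / m) ^ δ * (2 / (s:ℝ)) := by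
    rw [Real.rpow_sub_one hs0.ne', Real.div_rpow hs0.le hm0.le]
    ring
  rw [k2]
  linarith
end

section
/- Fix α > 0 and define ϑ(2) = 1 and ϑ(m+1) = 1 + (1 − (1+α)/((2+α)m − 1)) ϑ(m) for integers m ≥ 2. Then there exists a constant C < ∞ such that for all m ≥ 2, |ϑ(m) − m(2+α)/(3+2α)| ≤ C. -/
/-- The expected number of leaves in the (no change point) preferential attachment tree of size
`m` with parameter `α`: `ϑ(2) = 1` and `ϑ(m+1) = 1 + (1 − (1+α)/((2+α)m − 1)) ϑ(m)` for
`m ≥ 2`. -/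
noncomputable def thetaNC (α : ℝ) : ℕ → ℝ
  | 0 => 0
  | 1 => 0
  | 2 => 1
  | m + 3 => 1 + (1 - (1 + α) / ((2 + α) * ((m : ℝ) + 2) - 1)) * thetaNC α (m + 2)

/-- The recursion has the exact solution `((2+α)m − 1)/(3+2α)`. -/
theorem thetaNC_exact (α : ℝ) (hα : 0 < α) (k : ℕ) :
    thetaNC α (k + 2) = ((2 + α) * ((k : ℝ) + 2) - 1) / (3 + 2 * α) := by
  have h3 : (3 + 2 * α) ≠ 0 := by positivity
  induction k with
  | zero =>
    rw [thetaNC, eq_div_iff h3]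
    push_cast
    ring
  | succ k ih =>
    have hk : (0 : ℝ) ≤ k := Nat.cast_nonneg k
    have hd : ((2 + α) * ((k : ℝ) + 2) - 1) ≠ 0 := by
      have : 0 < (2 + α) * ((k : ℝ) + 2) - 1 := by nlinarith [mul_nonneg hα.le hk]
      exact this.ne'
    rw [show k + 1 + 2 = k + 3 from rfl, thetaNC, ih]
    push_cast
    rw [sub_mul, div_mul_div_comm, mul_comm (1 + α), mul_div_mul_left _ _ hd]
    field_simp
    ring

/-- Fix `α > 0`. Then there exists a constant `C < ∞` such that for all
`m ≥ 2`, `|ϑ(m) − m(2+α)/(3+2α)| ≤ C`. -/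
theorem stmt_18 (α : ℝ) (hα : 0 < α) :
    ∃ C : ℝ, 0 < C ∧ ∀ m : ℕ, 2 ≤ m →
      |thetaNC α m - (m : ℝ) * (2 + α) / (3 + 2 * α)| ≤ C := by
  have h3 : 0 < 3 + 2 * α := by positivity
  refine ⟨1 / (3 + 2 * α), by positivity, ?_⟩
  intro m hm
  obtain ⟨k, rfl⟩ := Nat.exists_eq_add_of_le' hm
  rw [thetaNC_exact α hα k, ← sub_div, abs_div, abs_of_pos h3]
  push_cast
  rw [show (2 + α) * ((k : ℝ) + 2) - 1 - ((k : ℝ) + 2) * (2 + α) = -1 by ring]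
  simp
end
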